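/- Every finite permutation (a finite set equipped with two total orders) is quasi-projective. -/

import Mathlib

/-- `r` is a (reflexive) total order on `A`. -/
def IsTotalOrderRel {A : Type} (r : A → A → Prop) : Prop :=
  (∀ a, r a a) ∧ (∀ a b, r a b → r b a → a = b) ∧
    (∀ a b c, r a b → r b c → r a c) ∧ (∀ a b, r a b ∨ r b a)

/-- A homomorphism of permutations preserves both total orders. -/
def IsPermHom {A B : Type} (r₁ r₂ : A → A → Prop) (s₁ s₂ : B → B → Prop)
    (g : A → B) : Prop :=
  (∀ a b, r₁ a b → s₁ (g a) (g b)) ∧ (∀ a b, r₂ a b → s₂ (g a) (g b))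

/-- Any section of a monotone map between total orders is monotone. -/
theorem IsTotalOrderRel.rel_section {A B : Type} {r : A → A → Prop} {s : B → B → Prop}
    (hr : IsTotalOrderRel r) (hs : IsTotalOrderRel s) {j : A → B}
    (hj : ∀ a b, r a b → s (j a) (j b)) {i : B → A} (hi : Function.RightInverse i j)
    {x y : B} (hxy : s x y) : r (i x) (i y) := by
  obtain ⟨hrefl, -, -, htotal⟩ := hr
  refine (htotal (i x) (i y)).elim id fun h => ?_
  have hyx : s y x := by simpa only [hi x, hi y] using hj _ _ h
  rw [hs.2.1 x y hxy hyx]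
  exact hrefl _

/-- A finite permutation `(A, r₁, r₂)` is quasi-projective. -/
theorem finite_permutation_quasiProjective (A : Type) [Fintype A]
    (r₁ r₂ : A → A → Prop) (hr₁ : IsTotalOrderRel r₁) (hr₂ : IsTotalOrderRel r₂)
    (B : Type) [Fintype B]
    (s₁ s₂ : B → B → Prop) (hs₁ : IsTotalOrderRel s₁) (hs₂ : IsTotalOrderRel s₂)
    (f j : A → B) (hf : IsPermHom r₁ r₂ s₁ s₂ f) (hj : IsPermHom r₁ r₂ s₁ s₂ j)
    (hjsurj : Function.Surjective j) :
    ∃ φ : A → A, IsPermHom r₁ r₂ r₁ r₂ φ ∧ j ∘ φ = f := by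
  obtain ⟨i, hi⟩ := hjsurj.hasRightInverse
  exact ⟨i ∘ f, ⟨fun a b h => hr₁.rel_section hs₁ hj.1 hi (hf.1 a b h),
    fun a b h => hr₂.rel_section hs₂ hj.2 hi (hf.2 a b h)⟩, funext fun a => hi (f a)⟩
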